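/- Suppose the data contain at least one interior group (1 ≤ k_y ≤ k), let u > 0 with k_y ≥ u + 1, and let g be a probability density on ℝ^m. Then ∫_{ℝ^m} ∫_0^∞ r^{−(u+1)} · g(β) · L(r, β) dr dβ < ∞, i.e., the posterior under the improper hyper-prior dr/r^{u+1} on r and a proper hyper-prior on β is proper. -/

import Mathlib

open MeasureTheory Real Filter Finset

/-- The Beta function `B(a,b) = ∫₀¹ v^(a-1) (1-v)^(b-1) dv`. -/
noncomputable def betaFn (a b : ℝ) : ℝ :=
  ∫ v in (0:ℝ)..1, v ^ (a - 1) * (1 - v) ^ (b - 1)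

/-- The standard logistic function `σ(t) = exp t / (1 + exp t)`. -/
noncomputable def logistic (t : ℝ) : ℝ := Real.exp t / (1 + Real.exp t)

/-- Expected random effect `p_j^E(β) = σ(x_jᵀ β)`. -/
noncomputable def pE {k m : ℕ} (x : Fin k → Fin m → ℝ) (j : Fin k) (β : Fin m → ℝ) : ℝ :=
  logistic (∑ i, x j i * β i)

/-- The Beta-Binomial likelihood
`L(r,β) = ∏ⱼ C(nⱼ,yⱼ) B(yⱼ + r pⱼᴱ, nⱼ - yⱼ + r qⱼᴱ) / B(r pⱼᴱ, r qⱼᴱ)`. -/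
noncomputable def bbL {k m : ℕ} (x : Fin k → Fin m → ℝ) (n y : Fin k → ℕ)
    (r : ℝ) (β : Fin m → ℝ) : ℝ :=
  ∏ j : Fin k,
    ((n j).choose (y j) : ℝ) *
      betaFn ((y j : ℝ) + r * pE x j β) (((n j : ℝ) - (y j : ℝ)) + r * (1 - pE x j β)) /
      betaFn (r * pE x j β) (r * (1 - pE x j β))

theorem betaFn_eq_beta {a b : ℝ} (ha : 0 < a) (hb : 0 < b) :
    betaFn a b = ProbabilityTheory.beta a b := by
  rw [ProbabilityTheory.beta_eq_betaIntegralReal a b ha hb, Complex.betaIntegral]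
  have h : (∫ v in (0:ℝ)..1, (v : ℂ) ^ ((a : ℂ) - 1) * (1 - (v : ℂ)) ^ ((b : ℂ) - 1)) =
      ((betaFn a b : ℝ) : ℂ) := by
    rw [betaFn, ← intervalIntegral.integral_ofReal]
    refine intervalIntegral.integral_congr fun v hv => ?_
    rw [Set.uIcc_of_le zero_le_one] at hv
    simp only [Complex.ofReal_mul]
    rw [Complex.ofReal_cpow hv.1, Complex.ofReal_cpow (sub_nonneg.2 hv.2)]
    push_cast
    rfl
  rw [h, Complex.ofReal_re]

theorem betaFn_pos {a b : ℝ} (ha : 0 < a) (hb : 0 < b) : 0 < betaFn a b :=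
  betaFn_eq_beta ha hb ▸ ProbabilityTheory.beta_pos ha hb

theorem betaFn_comm {a b : ℝ} (ha : 0 < a) (hb : 0 < b) : betaFn a b = betaFn b a := by
  rw [betaFn_eq_beta ha hb, betaFn_eq_beta hb ha, ProbabilityTheory.beta, ProbabilityTheory.beta,
    add_comm b a, mul_comm (Real.Gamma b)]

theorem betaFn_add_one_left {a b : ℝ} (ha : 0 < a) (hb : 0 < b) :
    betaFn (a + 1) b = a / (a + b) * betaFn a b := by
  have hab : 0 < a + b := add_pos ha hb
  rw [betaFn_eq_beta (by positivity) hb, betaFn_eq_beta ha hb, ProbabilityTheory.beta,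
    ProbabilityTheory.beta, add_right_comm, Real.Gamma_add_one ha.ne', Real.Gamma_add_one hab.ne']
  have := (Real.Gamma_pos_of_pos hab).ne'
  field_simp

theorem betaFn_add_one_right {a b : ℝ} (ha : 0 < a) (hb : 0 < b) :
    betaFn a (b + 1) = b / (a + b) * betaFn a b := by
  rw [betaFn_comm ha (by positivity), betaFn_add_one_left hb ha, betaFn_comm hb ha, add_comm b a]

theorem betaFn_nat_add_left_le {a b : ℝ} (ha : 0 < a) (hb : 0 < b) (s : ℕ) :
    betaFn (s + a) b ≤ betaFn a b := by
  induction s with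
  | zero => simp
  | succ s ih =>
    have hs : 0 < (s : ℝ) + a := by positivity
    rw [Nat.cast_succ, add_right_comm, betaFn_add_one_left hs hb]
    refine le_trans (mul_le_of_le_one_left (betaFn_pos hs hb).le ?_) ih
    exact div_le_one_of_le₀ (by linarith) (by positivity)

theorem betaFn_nat_add_le {a b : ℝ} (ha : 0 < a) (hb : 0 < b) (s t : ℕ) :
    betaFn (s + a) (t + b) ≤ betaFn a b := by
  have ht : 0 < (t : ℝ) + b := by positivity
  refine (betaFn_nat_add_left_le ha ht s).trans ?_
  rw [betaFn_comm ha ht, betaFn_comm ha hb]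
  exact betaFn_nat_add_left_le hb ha t

theorem betaFn_add_one_add_one_le {a b : ℝ} (ha : 0 < a) (hb : 0 < b) :
    betaFn (a + 1) (b + 1) ≤ (a + b) * betaFn a b := by
  rw [betaFn_add_one_left ha (by positivity), betaFn_add_one_right ha hb, ← mul_assoc]
  refine mul_le_mul_of_nonneg_right ?_ (betaFn_pos ha hb).le
  have h1 : a / (a + (b + 1)) ≤ 1 := div_le_one_of_le₀ (by linarith) (by positivity)
  have h2 : a / (a + (b + 1)) ≤ a := div_le_self ha.le (by linarith)
  have h3 : b / (a + b) ≤ 1 := div_le_one_of_le₀ (by linarith) (by positivity)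
  have h4 : 0 ≤ b / (a + b) := by positivity
  nlinarith

theorem betaFn_nat_add_le_mul {a b : ℝ} (ha : 0 < a) (hb : 0 < b) {s t : ℕ}
    (hs : 1 ≤ s) (ht : 1 ≤ t) :
    betaFn (s + a) (t + b) ≤ (a + b) * betaFn a b := by
  obtain ⟨s, rfl⟩ := Nat.exists_eq_add_of_le' hs
  obtain ⟨t, rfl⟩ := Nat.exists_eq_add_of_le' ht
  rw [Nat.cast_succ, Nat.cast_succ, add_assoc, add_assoc, add_comm 1 a, add_comm 1 b]
  exact (betaFn_nat_add_le (by positivity) (by positivity) s t).trans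
    (betaFn_add_one_add_one_le ha hb)

theorem logistic_pos (t : ℝ) : 0 < logistic t := by
  unfold logistic
  positivity

theorem logistic_lt_one (t : ℝ) : logistic t < 1 := by
  rw [logistic, div_lt_one (by positivity)]
  linarith

/-- Each interior group contributes a factor at most `min 1 r` to the likelihood, up to the
binomial coefficient; every other group contributes at most its binomial coefficient. -/
theorem bbL_le {k m : ℕ} (x : Fin k → Fin m → ℝ) (n y : Fin k → ℕ) (hy : ∀ j, y j ≤ n j)
    {r : ℝ} (hr : 0 < r) (β : Fin m → ℝ) :
    bbL x n y r β ≤ (∏ j, ((n j).choose (y j) : ℝ)) *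
      min 1 r ^ (Finset.univ.filter fun j => 1 ≤ y j ∧ y j ≤ n j - 1).card := by
  have hprod : min 1 r ^ (Finset.univ.filter fun j => 1 ≤ y j ∧ y j ≤ n j - 1).card =
      ∏ j : Fin k, if 1 ≤ y j ∧ y j ≤ n j - 1 then min 1 r else 1 := by
    rw [← Finset.prod_filter, Finset.prod_const]
  rw [hprod, ← Finset.prod_mul_distrib, bbL]
  have ha (j) : 0 < r * pE x j β := mul_pos hr (logistic_pos _)
  have hb (j) : 0 < r * (1 - pE x j β) := mul_pos hr (sub_pos.2 (logistic_lt_one _))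
  simp only [← Nat.cast_sub (hy _), mul_div_assoc]
  refine Finset.prod_le_prod (fun j _ => ?_) fun j _ => ?_
  · have := ha j
    have := hb j
    exact mul_nonneg (Nat.cast_nonneg _)
      (div_nonneg (betaFn_pos (by positivity) (by positivity)).le (betaFn_pos (ha j) (hb j)).le)
  · refine mul_le_mul_of_nonneg_left ?_ (Nat.cast_nonneg _)
    rw [div_le_iff₀ (betaFn_pos (ha j) (hb j))]
    have h1 := betaFn_nat_add_le (ha j) (hb j) (y j) (n j - y j)
    split_ifs with h
    · have h2 := betaFn_nat_add_le_mul (ha j) (hb j) h.1 (t := n j - y j) (by omega)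
      rw [← mul_add, add_sub_cancel, mul_one] at h2
      rcases min_choice 1 r with h' | h' <;> rw [h']
      · rwa [one_mul]
      · exact h2
    · rwa [one_mul]

theorem lintegral_rpow_mul_min_pow_lt_top {u : ℝ} (hu : 0 < u) {d : ℕ} (hd : u + 1 ≤ d) :
    ∫⁻ r in Set.Ioi (0:ℝ), ENNReal.ofReal (r ^ (-(u + 1)) * min 1 r ^ d) < ⊤ := by
  rw [← Set.Ioc_union_Ioi_eq_Ioi (zero_le_one' ℝ)]
  refine (lintegral_union_le _ _ _).trans_lt (ENNReal.add_lt_top.2 ⟨?_, ?_⟩)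
  · refine (setLIntegral_mono (g := fun _ => 1) measurable_const fun r hr => ?_).trans_lt ?_
    · rw [ENNReal.ofReal_le_one, min_eq_right hr.2, ← Real.rpow_natCast,
        ← Real.rpow_add hr.1]
      exact Real.rpow_le_one hr.1.le hr.2 (by linarith)
    · simp
  · refine (setLIntegral_mono' (g := fun r => ENNReal.ofReal (r ^ (-(u + 1)))) measurableSet_Ioi
      fun r hr => ?_).trans_lt ?_
    · rw [min_eq_left (le_of_lt hr), one_pow, mul_one]
    · exact (integrableOn_Ioi_rpow_of_lt (by linarith) one_pos).lintegral_lt_top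

/-- Theorem 2 (sufficiency) + Corollary 1: at least one interior group, improper
hyper-prior `dr/r^{u+1}` on `r` with `k_y ≥ u + 1`, and proper hyper-prior density `g`
on `β`. Then the posterior is proper. -/
theorem posterior_proper_improper_r_proper_beta_mixed (k m : ℕ) (x : Fin k → Fin m → ℝ)
    (n y : Fin k → ℕ) (hn : ∀ j, 1 ≤ n j) (hy : ∀ j, y j ≤ n j)
    (hky : 1 ≤ (Finset.univ.filter fun j => 1 ≤ y j ∧ y j ≤ n j - 1).card)
    (u : ℝ) (hu : 0 < u)
    (hk : u + 1 ≤ ((Finset.univ.filter fun j => 1 ≤ y j ∧ y j ≤ n j - 1).card : ℝ))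
    (g : (Fin m → ℝ) → ℝ) (hgm : Measurable g) (hg0 : ∀ β, 0 ≤ g β)
    (hg1 : ∫⁻ β : Fin m → ℝ, ENNReal.ofReal (g β) = 1) :
    (∫⁻ β : Fin m → ℝ, ∫⁻ r in Set.Ioi (0:ℝ),
        ENNReal.ofReal (r ^ (-(u + 1)) * g β * bbL x n y r β)) < ⊤ := by
  have hC : 0 ≤ ∏ j, ((n j).choose (y j) : ℝ) := by positivity
  set d := (Finset.univ.filter fun j => 1 ≤ y j ∧ y j ≤ n j - 1).card
  have hbound (β : Fin m → ℝ) :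
      ∫⁻ r in Set.Ioi (0:ℝ), ENNReal.ofReal (r ^ (-(u + 1)) * g β * bbL x n y r β) ≤
        ENNReal.ofReal (g β) * (ENNReal.ofReal (∏ j, ((n j).choose (y j) : ℝ)) *
          ∫⁻ r in Set.Ioi (0:ℝ), ENNReal.ofReal (r ^ (-(u + 1)) * min 1 r ^ d)) := by
    rw [← lintegral_const_mul' _ _ ENNReal.ofReal_ne_top,
      ← lintegral_const_mul' _ _ ENNReal.ofReal_ne_top]
    refine setLIntegral_mono' measurableSet_Ioi fun r (hr : 0 < r) => ?_
    rw [← ENNReal.ofReal_mul hC, ← ENNReal.ofReal_mul (hg0 β)]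
    refine ENNReal.ofReal_le_ofReal ?_
    calc r ^ (-(u + 1)) * g β * bbL x n y r β
        ≤ r ^ (-(u + 1)) * g β * ((∏ j, ((n j).choose (y j) : ℝ)) * min 1 r ^ d) :=
          mul_le_mul_of_nonneg_left (bbL_le x n y hy hr β)
            (mul_nonneg (Real.rpow_nonneg hr.le _) (hg0 β))
      _ = g β * ((∏ j, ((n j).choose (y j) : ℝ)) * (r ^ (-(u + 1)) * min 1 r ^ d)) := by ring
  have hK : ENNReal.ofReal (∏ j, ((n j).choose (y j) : ℝ)) *
      ∫⁻ r in Set.Ioi (0:ℝ), ENNReal.ofReal (r ^ (-(u + 1)) * min 1 r ^ d) < ⊤ :=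
    ENNReal.mul_lt_top ENNReal.ofReal_lt_top (lintegral_rpow_mul_min_pow_lt_top hu hk)
  refine (lintegral_mono hbound).trans_lt ?_
  rwa [lintegral_mul_const' _ _ hK.ne, hg1, one_mul]
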